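/- arXiv:1811.08725 — 6 statements merged into one kernel-verified Lean document; each statement's English description precedes it below -/
import Mathlib

section
/- For every function f : Y → ℝ on the finite product space Y = Y_1 × ⋯ × Y_D, the log-partition function A(f) = log Σ_{y∈Y} exp(f(y)) is bounded above by the Gumbel perturb-and-MAP value: A(f) ≤ A_G(f), where A_G(f) = E_z[ max_{y∈Y} ( f(y) + Σ_{d=1}^D z_d(y_d) ) ] and z = (z_d(k))_{d∈{1,…,D}, k∈Y_d} is a family of independent mean-zero Gumbel random variables. -/
open MeasureTheory Real

namespace GumbelAux

lemma integrableOn_log_mul_exp :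
    IntegrableOn (fun t : ℝ => Real.log t * Real.exp (-t)) (Set.Ioi 0) := by
  have h := (mellin_hasDerivAt_of_isBigO_rpow (E := ℂ) (a := 2) (b := 0) (s := 1)
    (f := fun t : ℝ => ((Real.exp (-t) : ℝ) : ℂ)) ?_ ?_ ?_ ?_ ?_).1
  · have h2 : IntegrableOn (fun t : ℝ => (((Real.log t * Real.exp (-t) : ℝ)) : ℂ)) (Set.Ioi 0) := by
      refine h.congr_fun (fun t ht => ?_) measurableSet_Ioi
      simp
    exact h2.re
  · refine (Continuous.continuousOn ?_).locallyIntegrableOn measurableSet_Ioi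
    exact Complex.continuous_ofReal.comp (Real.continuous_exp.comp continuous_neg)
  · rw [← Asymptotics.isBigO_norm_left]
    simp_rw [Complex.norm_real, Asymptotics.isBigO_norm_left]
    simpa only [neg_one_mul] using (isLittleO_exp_neg_mul_rpow_atTop zero_lt_one _).isBigO
  · norm_num
  · simp_rw [neg_zero, rpow_zero]
    refine Asymptotics.isBigO_const_of_tendsto (?_ : Filter.Tendsto _ _ (nhds (1 : ℂ))) one_ne_zero
    rw [(by simp : (1 : ℂ) = Real.exp (-0))]
    exact (Complex.continuous_ofReal.comp
      (Real.continuous_exp.comp continuous_neg)).continuousWithinAt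
  · norm_num

lemma integral_log_mul_exp :
    ∫ t in Set.Ioi (0 : ℝ), Real.log t * Real.exp (-t) = -Real.eulerMascheroniConstant := by
  have h1 := Complex.hasDerivAt_GammaIntegral (s := 1) (by norm_num)
  have h2 := Complex.hasDerivAt_Gamma_one
  have h3 : Complex.Gamma =ᶠ[nhds 1] Complex.GammaIntegral := by
    have : ∀ᶠ s : ℂ in nhds 1, 0 < s.re :=
      (isOpen_lt continuous_const Complex.continuous_re).mem_nhds (by simp)
    filter_upwards [this] with s hs
    exact Complex.Gamma_eq_integral hs
  have h4 := (h1.congr_of_eventuallyEq h3).unique h2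
  have h5 : (∫ t : ℝ in Set.Ioi 0, ((t : ℂ) ^ ((1 : ℂ) - 1) * (Real.log t * Real.exp (-t) : ℂ)))
      = ∫ t : ℝ in Set.Ioi 0, (((Real.log t * Real.exp (-t) : ℝ)) : ℂ) := by
    congr 1; ext t; simp
  rw [h5, integral_complex_ofReal] at h4
  exact_mod_cast h4

noncomputable def expo : Measure ℝ :=
  (volume.restrict (Set.Ioi 0)).withDensity (fun x => ENNReal.ofReal (Real.exp (-x)))

lemma expo_Ici {a : ℝ} (ha : 0 < a) : expo (Set.Ici a) = ENNReal.ofReal (Real.exp (-a)) := by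
  rw [expo, withDensity_apply _ measurableSet_Ici, Measure.restrict_restrict measurableSet_Ici]
  have : Set.Ici a ∩ Set.Ioi 0 = Set.Ici a := by
    ext x; simp only [Set.mem_inter_iff, Set.mem_Ici, Set.mem_Ioi]
    constructor
    · exact fun h => h.1
    · exact fun h => ⟨h, ha.trans_le h⟩
  rw [this, ← ofReal_integral_eq_lintegral_ofReal, integral_Ici_eq_integral_Ioi,
    integral_exp_neg_Ioi]
  · rw [← IntegrableOn, integrableOn_Ici_iff_integrableOn_Ioi]
    exact integrableOn_exp_neg_Ioi a
  · exact Filter.Eventually.of_forall fun x => (Real.exp_pos _).le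

lemma expo_univ : expo Set.univ = 1 := by
  rw [expo, withDensity_apply _ MeasurableSet.univ, Measure.restrict_univ,
    ← ofReal_integral_eq_lintegral_ofReal, integral_exp_neg_Ioi]
  · simp
  · exact integrableOn_exp_neg_Ioi 0
  · exact Filter.Eventually.of_forall fun x => (Real.exp_pos _).le

instance : IsProbabilityMeasure expo := ⟨expo_univ⟩

lemma expo_pos : ∀ᵐ x ∂expo, 0 < x := by
  apply (withDensity_absolutelyContinuous _ _).ae_le
  exact ae_restrict_mem measurableSet_Ioi

lemma meas_tr : Measurable (fun u : ℝ => -Real.log u - Real.eulerMascheroniConstant) := by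
  fun_prop

variable {μ : Measure ℝ} [IsProbabilityMeasure μ]

lemma gumbel_eq (hμ : ∀ t : ℝ, μ (Set.Iic t)
      = ENNReal.ofReal (Real.exp (-Real.exp (-(t + Real.eulerMascheroniConstant))))) :
    μ = expo.map (fun u : ℝ => -Real.log u - Real.eulerMascheroniConstant) := by
  have := Measure.isProbabilityMeasure_map (μ := expo) meas_tr.aemeasurable
  refine Measure.ext_of_Iic _ _ fun t => ?_
  rw [hμ, Measure.map_apply meas_tr measurableSet_Iic, ← expo_Ici (Real.exp_pos _)]
  apply measure_congr
  filter_upwards [expo_pos] with u hu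
  apply propext
  change Real.exp _ ≤ u ↔ -Real.log u - _ ≤ t
  rw [← Real.le_log_iff_exp_le hu]
  constructor <;> intro h <;> linarith

lemma integrable_log : Integrable (fun u : ℝ => Real.log u) expo := by
  rw [expo, integrable_withDensity_iff_integrable_smul' (by fun_prop) (by simp)]
  refine integrableOn_log_mul_exp.congr (Filter.Eventually.of_forall fun x => ?_)
  simp [ENNReal.toReal_ofReal (Real.exp_pos _).le, mul_comm]

lemma integral_log : ∫ u, Real.log u ∂expo = -Real.eulerMascheroniConstant := by
  rw [expo, integral_withDensity_eq_integral_toReal_smul (by fun_prop) (by simp),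
    ← integral_log_mul_exp]
  congr 1; ext x
  simp [ENNReal.toReal_ofReal (Real.exp_pos _).le, mul_comm]

lemma gumbel_integrable (hμ : ∀ t : ℝ, μ (Set.Iic t)
      = ENNReal.ofReal (Real.exp (-Real.exp (-(t + Real.eulerMascheroniConstant))))) :
    Integrable (fun x : ℝ => x) μ := by
  rw [gumbel_eq hμ, integrable_map_measure (by fun_prop) meas_tr.aemeasurable]
  exact integrable_log.neg.sub (integrable_const _)

lemma gumbel_mean (hμ : ∀ t : ℝ, μ (Set.Iic t)
      = ENNReal.ofReal (Real.exp (-Real.exp (-(t + Real.eulerMascheroniConstant))))) :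
    ∫ x, x ∂μ = 0 := by
  rw [gumbel_eq hμ, integral_map meas_tr.aemeasurable (by fun_prop),
    integral_sub (f := fun u : ℝ => -Real.log u) integrable_log.neg (integrable_const _),
    integral_neg, integral_log]
  simp

lemma gumbel_max (hμ : ∀ t : ℝ, μ (Set.Iic t)
      = ENNReal.ofReal (Real.exp (-Real.exp (-(t + Real.eulerMascheroniConstant)))))
    {K : Type} [Fintype K] [Nonempty K] (g : K → ℝ) :
    ∫ z : K → ℝ, Finset.univ.sup' Finset.univ_nonempty (fun k => g k + z k)
      ∂(Measure.pi fun _ => μ) = Real.log (∑ k, Real.exp (g k)) := by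
  set L := Real.log (∑ k, Real.exp (g k)) with hL
  have hpos : 0 < ∑ k, Real.exp (g k) :=
    Finset.sum_pos (fun k _ => Real.exp_pos _) Finset.univ_nonempty
  have hM : Measurable (fun z : K → ℝ =>
      Finset.univ.sup' Finset.univ_nonempty (fun k => g k + z k)) := by
    have := Finset.measurable_sup' (s := (Finset.univ : Finset K)) Finset.univ_nonempty
      (f := fun k (z : K → ℝ) => g k + z k) (fun k _ => by fun_prop)
    convert this using 2 with z
    simp
  have hadd : Measurable (fun x : ℝ => x + L) := by fun_prop
  have key : (Measure.pi fun _ : K => μ).map (fun z : K → ℝ =>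
      Finset.univ.sup' Finset.univ_nonempty (fun k => g k + z k)) = μ.map (fun x => x + L) := by
    have := Measure.isProbabilityMeasure_map (μ := Measure.pi fun _ : K => μ) hM.aemeasurable
    have := Measure.isProbabilityMeasure_map (μ := μ) hadd.aemeasurable
    refine Measure.ext_of_Iic _ _ fun t => ?_
    rw [Measure.map_apply hM measurableSet_Iic, Measure.map_apply hadd measurableSet_Iic]
    have e1 : (fun z : K → ℝ => Finset.univ.sup' Finset.univ_nonempty (fun k => g k + z k)) ⁻¹'
        Set.Iic t = Set.univ.pi (fun k => Set.Iic (t - g k)) := by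
      ext z
      simp only [Set.mem_preimage, Set.mem_Iic, Finset.sup'_le_iff, Set.mem_pi, Set.mem_univ,
        Finset.mem_univ, forall_true_left]
      exact forall_congr' fun k => by constructor <;> intro h <;> linarith
    have e2 : (fun x : ℝ => x + L) ⁻¹' Set.Iic t = Set.Iic (t - L) := by
      ext x; simp [le_sub_iff_add_le]
    rw [e1, e2, Measure.pi_pi, hμ]
    simp_rw [hμ]
    rw [← ENNReal.ofReal_prod_of_nonneg (fun k _ => (Real.exp_pos _).le), ← Real.exp_sum]
    congr 2
    rw [Finset.sum_neg_distrib]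
    congr 1
    have : ∀ c : ℝ, Real.exp (-(t - c + Real.eulerMascheroniConstant))
        = Real.exp c * Real.exp (-(t + Real.eulerMascheroniConstant)) := by
      intro c; rw [← Real.exp_add]; congr 1; ring
    simp_rw [this]
    rw [← Finset.sum_mul, hL, Real.exp_log hpos]
  have h1 := integral_map (μ := Measure.pi fun _ : K => μ) hM.aemeasurable
    (f := fun x : ℝ => x) (by fun_prop)
  rw [← h1, key, integral_map hadd.aemeasurable (by fun_prop),
    integral_add (gumbel_integrable hμ) (integrable_const _), gumbel_mean hμ]
  simp

lemma integrable_sup' {Ω ι : Type*} [MeasurableSpace Ω] {P : Measure Ω} {s : Finset ι}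
    (hs : s.Nonempty) {F : ι → Ω → ℝ} (hF : ∀ i, Integrable (F i) P) :
    Integrable (fun ω => s.sup' hs (fun i => F i ω)) P := by
  have : Integrable (s.sup' hs F) P :=
    Finset.sup'_induction hs F (p := fun G => Integrable G P) (fun a ha b hb => ha.sup hb)
      (fun i _ => hF i)
  convert this using 1
  ext ω
  simp

lemma perturb_bound (hμ : ∀ t : ℝ, μ (Set.Iic t)
      = ENNReal.ofReal (Real.exp (-Real.exp (-(t + Real.eulerMascheroniConstant))))) (D : ℕ) :
    ∀ {Y : Fin D → Type} [∀ d, Fintype (Y d)] [∀ d, Nonempty (Y d)] (f : (∀ d, Y d) → ℝ),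
    Real.log (∑ y : ∀ d, Y d, Real.exp (f y))
      ≤ ∫ z : (∀ d : Fin D, Y d → ℝ),
          (Finset.univ.sup' Finset.univ_nonempty
            (fun y : ∀ d, Y d => f y + ∑ d : Fin D, z d (y d)))
          ∂(Measure.pi fun _ => Measure.pi fun _ => μ) := by
  have hterm : ∀ (D : ℕ) {Y : Fin D → Type} [∀ d, Fintype (Y d)] [∀ d, Nonempty (Y d)]
      (c : ℝ) (y : ∀ d, Y d), Integrable (fun z : (∀ d : Fin D, Y d → ℝ) =>
        c + ∑ d : Fin D, z d (y d)) (Measure.pi fun _ => Measure.pi fun _ => μ) := by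
    intro D Y _ _ c y
    refine (integrable_const _).add (integrable_finsetSum _ fun d _ => ?_)
    exact integrable_comp_eval (μ := fun d : Fin D => Measure.pi fun _ : Y d => μ) (i := d)
      (f := fun w : Y d → ℝ => w (y d))
      (integrable_comp_eval (μ := fun _ : Y d => μ) (i := y d) (f := fun x : ℝ => x)
        (gumbel_integrable hμ))
  induction D with
  | zero =>
    intro Y _ _ f
    simp
  | succ D ih =>
    intro Y _ _ f
    have mp := (measurePreserving_piFinSuccAbove
      (fun d : Fin (D + 1) => Measure.pi fun _ : Y d => μ) 0).symm
    have hI := integrable_sup' (P := Measure.pi fun d : Fin (D + 1) => Measure.pi fun _ : Y d => μ)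
      (s := (Finset.univ : Finset (∀ d, Y d))) Finset.univ_nonempty
      (fun y => hterm (D + 1) (f y) y)
    rw [← mp.integral_comp' ]
    have hI2 := (mp.integrable_comp_emb (MeasurableEquiv.measurableEmbedding _)).2 hI
    refine le_trans ?_ (integral_prod _ hI2).ge
    let A : Y 0 → ℝ := fun k =>
      Real.log (∑ y : ∀ d : Fin D, Y d.succ, Real.exp (f (Fin.cons k y)))
    have e0 : Real.log (∑ y : ∀ d, Y d, Real.exp (f y))
        = Real.log (∑ k, Real.exp (A k)) := by
      congr 1
      rw [← (Fin.consEquiv Y).sum_comp, Fintype.sum_prod_type]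
      refine Finset.sum_congr rfl fun k _ => ?_
      rw [Real.exp_log (Finset.sum_pos (fun k _ => Real.exp_pos _) Finset.univ_nonempty)]
      rfl
    rw [e0, ← gumbel_max hμ A]
    refine integral_mono_ae ?_ hI2.integral_prod_left ?_
    · exact integrable_sup' _ fun k => (integrable_const _).add
        (integrable_comp_eval (μ := fun _ : Y 0 => μ) (i := k) (f := fun x : ℝ => x)
        (gumbel_integrable hμ))
    · filter_upwards [hI2.prod_right_ae] with z0 hz0
      refine Finset.sup'_le _ _ fun k _ => ?_
      have h1 := ih (Y := fun d => Y d.succ) (fun y => f (Fin.cons k y))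
      have hI3 := integrable_sup'
        (P := Measure.pi fun d : Fin D => Measure.pi fun _ : Y d.succ => μ)
        (s := (Finset.univ : Finset (∀ d : Fin D, Y d.succ))) Finset.univ_nonempty
        (fun y => hterm D (Y := fun d => Y d.succ) (f (Fin.cons k y)) y)
      calc A k + z0 k ≤ (∫ z : (∀ d : Fin D, Y d.succ → ℝ),
          (Finset.univ.sup' Finset.univ_nonempty
            (fun y : ∀ d : Fin D, Y d.succ => f (Fin.cons k y) + ∑ d : Fin D, z d (y d)))
          ∂(Measure.pi fun _ => Measure.pi fun _ => μ)) + z0 k := by gcongr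
        _ = ∫ z : (∀ d : Fin D, Y d.succ → ℝ),
          ((Finset.univ.sup' Finset.univ_nonempty
            (fun y : ∀ d : Fin D, Y d.succ => f (Fin.cons k y) + ∑ d : Fin D, z d (y d))) + z0 k)
          ∂(Measure.pi fun _ => Measure.pi fun _ => μ) := by
            rw [integral_add hI3 (integrable_const _)]; simp
        _ ≤ _ := by
            refine integral_mono (hI3.add (integrable_const _)) hz0 fun z => ?_
            simp only [Function.comp_apply]
            rw [← le_sub_iff_add_le]
            refine Finset.sup'_le _ _ fun y _ => ?_
            rw [le_sub_iff_add_le]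
            refine le_trans (le_of_eq ?_) (Finset.le_sup' _ (Finset.mem_univ (Fin.cons k y)))
            rw [Fin.sum_univ_succ]
            have h0 : (MeasurableEquiv.piFinSuccAbove (fun d => Y d → ℝ) 0).symm (z0, z) 0 = z0 :=
              rfl
            have hs : ∀ d : Fin D, (MeasurableEquiv.piFinSuccAbove (fun d => Y d → ℝ) 0).symm
                (z0, z) d.succ = z d := fun d => rfl
            simp only [h0, hs, Fin.cons_zero, Fin.cons_succ]
            ring

end GumbelAux


/-- **Gumbel perturb-and-MAP upper bound** (Hazan & Jaakkola, Corollary 1).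
For any potential `f` on the finite product space `Y = Y₁ × ⋯ × Y_D`, the log-partition
function `A(f) = log ∑_y exp (f y)` is bounded above by the expected perturbed maximum
`A_G(f) = E_{z ∼ μ^{⊗I}} [ max_y ( f y + ∑_d z (d, y_d) ) ]`, where `μ` is the mean-zero
Gumbel distribution (CDF `t ↦ exp (−exp (−(t+γ)))`, `γ` the Euler–Mascheroni constant)
and the perturbations are indexed by `I = {(d, k) : d ∈ {1,…,D}, k ∈ Y_d}`. -/
theorem log_partition_le_gumbel_perturb_and_MAP
    {D : ℕ} {Y : Fin D → Type} [∀ d, Fintype (Y d)] [∀ d, Nonempty (Y d)]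
    (f : (∀ d, Y d) → ℝ)
    (μ : Measure ℝ) [IsProbabilityMeasure μ]
    (hμ : ∀ t : ℝ, μ (Set.Iic t)
      = ENNReal.ofReal (Real.exp (-Real.exp (-(t + Real.eulerMascheroniConstant))))) :
    Real.log (∑ y : ∀ d, Y d, Real.exp (f y))
      ≤ ∫ z : ((d : Fin D) × Y d) → ℝ,
          (Finset.univ.sup' Finset.univ_nonempty
            (fun y : ∀ d, Y d => f y + ∑ d : Fin D, z ⟨d, y d⟩))
          ∂(Measure.pi fun _ => μ) := by
  have hpi := Measure.infinitePi_map_piCurry_symm (X := fun (d : Fin D) (_ : Y d) => ℝ)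
    (fun (d : Fin D) (_ : Y d) => μ)
  simp only [Measure.infinitePi_eq_pi] at hpi
  rw [← hpi, MeasureTheory.integral_map_equiv]
  exact GumbelAux.perturb_bound hμ D f
end

section
/- Let K be a nonempty finite set, f : K → ℝ, and let (z_k)_{k∈K} be independent random variables each distributed according to the mean-zero Gumbel distribution. Then E[ max_{k∈K} ( f(k) + z_k ) ] = log Σ_{k∈K} exp(f(k)). In particular, the Gumbel upper bound on the log-partition function is tight when the output space has a single factor (D = 1). -/
open MeasureTheory Real

lemma gum_complex_integral :
    ∫ t : ℝ in Set.Ioi 0, ((Real.log t * Real.exp (-t) : ℝ) : ℂ)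
      = ((-Real.eulerMascheroniConstant : ℝ) : ℂ) := by
  have h1 := Complex.hasDerivAt_GammaIntegral (s := 1) (by simp)
  have h2 : HasDerivAt Complex.GammaIntegral (-(Real.eulerMascheroniConstant : ℂ)) 1 := by
    apply Complex.hasDerivAt_Gamma_one.congr_of_eventuallyEq
    have : IsOpen {s : ℂ | 0 < s.re} := Complex.continuous_re.isOpen_preimage _ isOpen_Ioi
    filter_upwards [this.mem_nhds (by simp : (1 : ℂ) ∈ {s : ℂ | 0 < s.re})] with a ha
    exact (Complex.Gamma_eq_integral ha).symm
  have h3 := h1.unique h2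
  simpa using h3

lemma gum_log_integral :
    ∫ t : ℝ in Set.Ioi 0, Real.log t * Real.exp (-t) = -Real.eulerMascheroniConstant := by
  have h := gum_complex_integral
  rw [integral_complex_ofReal] at h
  exact_mod_cast h

lemma gum_log_integrable :
    IntegrableOn (fun t : ℝ => Real.log t * Real.exp (-t)) (Set.Ioi 0) := by
  by_contra h
  have h1 := integral_undef h
  rw [gum_log_integral] at h1
  linarith [Real.one_half_lt_eulerMascheroniConstant]

/-- The standard exponential measure. -/
noncomputable def gumExp : Measure ℝ :=
  (volume.restrict (Set.Ioi 0)).withDensity (fun t => ENNReal.ofReal (Real.exp (-t)))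

lemma gumExp_apply_Ici {a : ℝ} (ha : 0 ≤ a) :
    gumExp (Set.Ici a) = ENNReal.ofReal (Real.exp (-a)) := by
  rw [gumExp, withDensity_apply _ measurableSet_Ici, Measure.restrict_restrict measurableSet_Ici]
  have : (Set.Ici a ∩ Set.Ioi 0 : Set ℝ) =ᵐ[volume] Set.Ioi a := by
    have h : (Set.Ioi a ∩ Set.Ioi 0 : Set ℝ) = Set.Ioi a := by
      ext x; simp only [Set.mem_inter_iff, Set.mem_Ioi]; constructor
      · exact fun h => h.1
      · exact fun h => ⟨h, by linarith⟩
    conv_rhs => rw [← h]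
    exact Ioi_ae_eq_Ici.symm.inter (Filter.EventuallyEq.refl _ _)
  rw [Measure.restrict_congr_set this,
    ← ofReal_integral_eq_lintegral_ofReal (integrableOn_exp_neg_Ioi a)
      (Filter.Eventually.of_forall fun _ => (Real.exp_pos _).le), integral_exp_neg_Ioi]

lemma gumExp_ae_pos : ∀ᵐ t ∂gumExp, 0 < t := by
  have h : gumExp ≪ volume.restrict (Set.Ioi (0 : ℝ)) := withDensity_absolutelyContinuous _ _
  exact h.ae_le (ae_restrict_mem measurableSet_Ioi)

instance gumExp_prob : IsProbabilityMeasure gumExp := by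
  constructor
  have h := gumExp_apply_Ici le_rfl
  simp only [neg_zero, Real.exp_zero, ENNReal.ofReal_one] at h
  apply le_antisymm
  · rw [← h]
    apply measure_mono_ae
    filter_upwards [gumExp_ae_pos] with t ht _
    exact ht.le
  · rw [← h]; exact measure_mono (Set.subset_univ _)

lemma gum_map_eq (μ : Measure ℝ) [IsProbabilityMeasure μ]
    (hμ : ∀ t : ℝ, μ (Set.Iic t)
      = ENNReal.ofReal (Real.exp (-Real.exp (-(t + Real.eulerMascheroniConstant))))) :
    gumExp.map (fun s => -Real.log s - Real.eulerMascheroniConstant) = μ := by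
  have hm : Measurable (fun s => -Real.log s - Real.eulerMascheroniConstant) := by fun_prop
  have := Measure.isProbabilityMeasure_map (μ := gumExp) hm.aemeasurable
  apply Measure.ext_of_Iic
  intro t
  rw [hμ, Measure.map_apply hm measurableSet_Iic, ← gumExp_apply_Ici (Real.exp_pos _).le]
  apply measure_congr
  filter_upwards [gumExp_ae_pos] with s hs
  apply propext
  change -Real.log s - Real.eulerMascheroniConstant ≤ t
    ↔ Real.exp (-(t + Real.eulerMascheroniConstant)) ≤ s
  rw [← Real.le_log_iff_exp_le hs]
  constructor <;> intro h <;> linarith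

lemma gum_integral_density (g : ℝ → ℝ) :
    ∫ s, g s ∂gumExp = ∫ t in Set.Ioi 0, g t * Real.exp (-t) := by
  rw [gumExp, integral_withDensity_eq_integral_toReal_smul (by fun_prop) (by simp)]
  apply integral_congr_ae
  filter_upwards with t
  simp [ENNReal.toReal_ofReal (Real.exp_pos _).le, mul_comm]

lemma gum_integrable : Integrable (fun s => Real.log s) gumExp := by
  rw [gumExp, integrable_withDensity_iff (by fun_prop) (by simp)]
  refine gum_log_integrable.congr ?_
  filter_upwards with t
  simp [ENNReal.toReal_ofReal (Real.exp_pos _).le]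

lemma gum_shift_mean (μ : Measure ℝ) [IsProbabilityMeasure μ]
    (hμ : ∀ t : ℝ, μ (Set.Iic t)
      = ENNReal.ofReal (Real.exp (-Real.exp (-(t + Real.eulerMascheroniConstant))))) (L : ℝ) :
    ∫ x, (x + L) ∂μ = L := by
  have hm : Measurable (fun s => -Real.log s - Real.eulerMascheroniConstant) := by fun_prop
  rw [← gum_map_eq μ hμ, integral_map hm.aemeasurable (by fun_prop)]
  have : ∀ s, -Real.log s - Real.eulerMascheroniConstant + L
    = (L - Real.eulerMascheroniConstant) - Real.log s := fun s => by ring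
  simp_rw [this]
  rw [integral_sub (integrable_const _) gum_integrable, gum_integral_density Real.log,
    gum_log_integral]
  simp


/-- **Gumbel-max expectation identity.** For a nonempty finite set `K`, `f : K → ℝ`, and
independent mean-zero Gumbel perturbations `(z_k)_{k ∈ K}` (modeled by the product measure
`μ^{⊗K}` of the mean-zero Gumbel distribution `μ`, whose CDF is
`t ↦ exp (−exp (−(t+γ)))` with `γ` the Euler–Mascheroni constant), the expectation of the
perturbed maximum equals the log-partition function:
`E [ max_k ( f k + z k ) ] = log ∑_k exp (f k)`. This is the tightness of the Gumbel
upper bound when the output space has a single factor (`D = 1`). -/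
theorem gumbel_max_expectation_eq_log_partition
    {K : Type} [Fintype K] [Nonempty K] (f : K → ℝ)
    (μ : Measure ℝ) [IsProbabilityMeasure μ]
    (hμ : ∀ t : ℝ, μ (Set.Iic t)
      = ENNReal.ofReal (Real.exp (-Real.exp (-(t + Real.eulerMascheroniConstant))))) :
    ∫ z : K → ℝ,
        (Finset.univ.sup' Finset.univ_nonempty (fun k : K => f k + z k))
        ∂(Measure.pi fun _ => μ)
      = Real.log (∑ k : K, Real.exp (f k)) := by
  set L := Real.log (∑ k : K, Real.exp (f k)) with hL
  have hpos : 0 < ∑ k : K, Real.exp (f k) :=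
    Finset.sum_pos (fun k _ => Real.exp_pos _) Finset.univ_nonempty
  set M : (K → ℝ) → ℝ :=
    fun z => Finset.univ.sup' Finset.univ_nonempty (fun k : K => f k + z k) with hMdef
  have hM : Measurable M := by
    have h := Finset.measurable_sup' (s := (Finset.univ : Finset K)) Finset.univ_nonempty
      (f := fun (k : K) (z : K → ℝ) => f k + z k) (fun k _ => by fun_prop)
    convert h using 1
    ext z
    simp [hMdef, Finset.sup'_apply]
  have hS : Measurable (fun x : ℝ => x + L) := by fun_prop
  have := Measure.isProbabilityMeasure_map (μ := Measure.pi fun _ : K => μ) hM.aemeasurable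
  have := Measure.isProbabilityMeasure_map (μ := μ) hS.aemeasurable
  have hlaw : (Measure.pi fun _ : K => μ).map M = μ.map (fun x => x + L) := by
    apply Measure.ext_of_Iic
    intro t
    rw [Measure.map_apply hM measurableSet_Iic, Measure.map_apply hS measurableSet_Iic]
    have h1 : M ⁻¹' Set.Iic t = Set.univ.pi (fun k => Set.Iic (t - f k)) := by
      ext z
      simp only [hMdef, Set.mem_preimage, Set.mem_Iic, Finset.sup'_le_iff, Finset.mem_univ,
        true_implies, Set.mem_univ_pi]
      exact forall_congr' fun k => by constructor <;> intro h <;> linarith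
    have h2 : (fun x : ℝ => x + L) ⁻¹' Set.Iic t = Set.Iic (t - L) := by
      ext x
      simp only [Set.mem_preimage, Set.mem_Iic]
      constructor <;> intro h <;> linarith
    rw [h1, h2, Measure.pi_pi, hμ]
    simp_rw [hμ]
    rw [← ENNReal.ofReal_prod_of_nonneg (fun _ _ => (Real.exp_pos _).le), ← Real.exp_sum,
      Finset.sum_neg_distrib]
    congr 3
    have h3 : ∀ a : ℝ, Real.exp (-(t - a + Real.eulerMascheroniConstant))
        = Real.exp a * Real.exp (-(t + Real.eulerMascheroniConstant)) := fun a => by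
      rw [← Real.exp_add]; congr 1; ring
    simp_rw [h3]
    rw [← Finset.sum_mul, hL, Real.exp_log hpos]
  calc ∫ z, M z ∂(Measure.pi fun _ : K => μ)
      = ∫ x, x ∂((Measure.pi fun _ : K => μ).map M) :=
        (integral_map (f := fun x : ℝ => x) hM.aemeasurable aestronglyMeasurable_id).symm
    _ = ∫ x, x + L ∂μ := by
        rw [hlaw, integral_map hS.aemeasurable (by fun_prop)]
    _ = L := gum_shift_mean μ hμ L
end

section
/- Let K be a nonempty finite set, f : K → ℝ, and let (z_k)_{k∈K} be independent random variables each distributed according to the mean-zero Gumbel distribution. Then almost surely the maximizer of k ↦ f(k) + z_k is unique, and for every k₀ ∈ K the probability that k₀ is the (unique) maximizer equals the softmax probability: P( f(k₀) + z_{k₀} > f(k) + z_k for all k ≠ k₀ ) = exp(f(k₀)) / Σ_{k∈K} exp(f(k)). -/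
open MeasureTheory Real

noncomputable def gumG (t : ℝ) : ℝ := Real.exp (-Real.exp (-(t + Real.eulerMascheroniConstant)))

lemma gumG_cont : Continuous gumG := by unfold gumG; fun_prop

lemma gumG_pos (t : ℝ) : 0 < gumG t := Real.exp_pos _

lemma gumG_lt_one (t : ℝ) : gumG t < 1 := by
  unfold gumG
  rw [Real.exp_lt_one_iff]
  have := Real.exp_pos (-(t + Real.eulerMascheroniConstant))
  linarith

lemma gumG_mono : StrictMono gumG := by
  intro a b h
  unfold gumG
  apply Real.exp_lt_exp.2
  apply neg_lt_neg
  apply Real.exp_lt_exp.2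
  linarith

lemma gumG_surj {x : ℝ} (h0 : 0 < x) (h1 : x < 1) : ∃ t, gumG t = x := by
  refine ⟨-Real.log (-Real.log x) - Real.eulerMascheroniConstant, ?_⟩
  have : Real.log x < 0 := Real.log_neg h0 h1
  unfold gumG
  rw [show -(-Real.log (-Real.log x) - Real.eulerMascheroniConstant
    + Real.eulerMascheroniConstant) = Real.log (-Real.log x) by ring,
    Real.exp_log (by linarith), neg_neg, Real.exp_log h0]

lemma gum_map (μ : Measure ℝ) [IsProbabilityMeasure μ]
    (hμ : ∀ t : ℝ, μ (Set.Iic t) = ENNReal.ofReal (gumG t)) :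
    μ.map gumG = volume.restrict (Set.Ioc 0 1) := by
  have : IsProbabilityMeasure (μ.map gumG) :=
    Measure.isProbabilityMeasure_map gumG_cont.measurable.aemeasurable
  apply Measure.ext_of_Iic
  intro x
  rw [Measure.map_apply gumG_cont.measurable measurableSet_Iic,
    Measure.restrict_apply measurableSet_Iic]
  rcases le_or_gt x 0 with h0 | h0
  · have e1 : gumG ⁻¹' Set.Iic x = ∅ := by
      ext t
      have := gumG_pos t
      simp only [Set.mem_preimage, Set.mem_Iic, Set.mem_empty_iff_false, iff_false]
      linarith
    have e2 : Set.Iic x ∩ Set.Ioc (0:ℝ) 1 = ∅ := by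
      ext t
      simp only [Set.mem_inter_iff, Set.mem_Iic, Set.mem_Ioc, Set.mem_empty_iff_false, iff_false]
      rintro ⟨a, b, c⟩
      linarith
    rw [e1, e2]; simp
  rcases le_or_gt 1 x with h1 | h1
  · have e1 : gumG ⁻¹' Set.Iic x = Set.univ := by
      ext t
      have := gumG_lt_one t
      simp only [Set.mem_preimage, Set.mem_Iic, Set.mem_univ, iff_true]
      linarith
    have e2 : Set.Iic x ∩ Set.Ioc (0:ℝ) 1 = Set.Ioc 0 1 := by
      ext t
      simp only [Set.mem_inter_iff, Set.mem_Iic, Set.mem_Ioc, and_iff_right_iff_imp]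
      rintro ⟨b, c⟩
      linarith
    rw [e1, e2]; simp
  · obtain ⟨t, rfl⟩ := gumG_surj h0 h1
    have e1 : gumG ⁻¹' Set.Iic (gumG t) = Set.Iic t := by
      ext s
      simp [gumG_mono.le_iff_le]
    have e2 : Set.Iic (gumG t) ∩ Set.Ioc (0:ℝ) 1 = Set.Ioc 0 (gumG t) := by
      ext s
      simp only [Set.mem_inter_iff, Set.mem_Iic, Set.mem_Ioc]
      constructor
      · rintro ⟨a, b, c⟩; exact ⟨b, a⟩
      · rintro ⟨a, b⟩; exact ⟨b, a, by linarith⟩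
    rw [e1, e2, hμ]; simp

lemma gum_Iio (μ : Measure ℝ) [IsProbabilityMeasure μ]
    (hμ : ∀ t : ℝ, μ (Set.Iic t) = ENNReal.ofReal (gumG t)) (t : ℝ) :
    μ (Set.Iio t) = ENNReal.ofReal (gumG t) := by
  have h : μ {t} = 0 := by
    have h1 : gumG ⁻¹' {gumG t} = {t} := by
      ext s
      simp [gumG_mono.injective.eq_iff]
    rw [← h1, ← Measure.map_apply gumG_cont.measurable (measurableSet_singleton _),
      gum_map μ hμ]
    simp
  rw [← hμ]
  apply measure_congr
  exact Iio_ae_eq_Iic' h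

lemma gum_lint (μ : Measure ℝ) [IsProbabilityMeasure μ]
    (hμ : ∀ t : ℝ, μ (Set.Iic t) = ENNReal.ofReal (gumG t)) (c : ℝ) (hc : 0 ≤ c) :
    ∫⁻ t, ENNReal.ofReal (gumG t ^ c) ∂μ = ENNReal.ofReal (1 / (1 + c)) := by
  have hm : Measurable fun u : ℝ => ENNReal.ofReal (u ^ c) := by fun_prop
  rw [← lintegral_map (f := fun u : ℝ => ENNReal.ofReal (u ^ c)) hm gumG_cont.measurable,
    gum_map μ hμ, ← ofReal_integral_eq_lintegral_ofReal]
  · rw [← intervalIntegral.integral_of_le zero_le_one, integral_rpow (Or.inl (by linarith))]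
    rw [Real.zero_rpow (by linarith), Real.one_rpow, sub_zero, add_comm]
  · rw [← IntegrableOn, ← intervalIntegrable_iff_integrableOn_Ioc_of_le zero_le_one]
    exact intervalIntegral.intervalIntegrable_rpow' (by linarith)
  · filter_upwards [ae_restrict_mem measurableSet_Ioc] with u hu
    exact Real.rpow_nonneg hu.1.le _

lemma gumG_shift (t a : ℝ) : gumG (t + a) = gumG t ^ Real.exp (-a) := by
  unfold gumG
  rw [← Real.exp_mul]
  congr 1
  rw [neg_mul, ← Real.exp_add]
  congr 2
  ring

lemma gum_meas {K : Type} [Fintype K] (f : K → ℝ) (k₀ : K) :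
    MeasurableSet {z : K → ℝ | ∀ k : K, k ≠ k₀ → f k + z k < f k₀ + z k₀} := by
  simp only [Set.ofPred_forall]
  refine MeasurableSet.iInter fun k => MeasurableSet.iInter fun _ => ?_
  exact measurableSet_lt (by fun_prop) (by fun_prop)

lemma gum_softmax
    {K : Type} [Fintype K] (f : K → ℝ)
    (μ : Measure ℝ) [IsProbabilityMeasure μ]
    (hμ : ∀ t : ℝ, μ (Set.Iic t) = ENNReal.ofReal (gumG t)) (k₀ : K) :
      (Measure.pi fun _ : K => μ) {z : K → ℝ | ∀ k : K, k ≠ k₀ → f k + z k < f k₀ + z k₀}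
        = ENNReal.ofReal (Real.exp (f k₀) / ∑ k : K, Real.exp (f k)) := by
  classical
  have hmp := measurePreserving_piEquivPiSubtypeProd (fun _ : K => μ) (fun k => k = k₀)
  set S : Set (({k // k = k₀} → ℝ) × ({k // ¬ k = k₀} → ℝ)) :=
    {p | ∀ k : {k // ¬ k = k₀}, f k + p.2 k < f k₀ + p.1 ⟨k₀, rfl⟩} with hS
  have hSm : MeasurableSet S := by
    rw [hS]
    simp only [Set.ofPred_forall]
    refine MeasurableSet.iInter fun k => ?_
    exact measurableSet_lt (by fun_prop) (by fun_prop)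
  have hpre : {z : K → ℝ | ∀ k : K, k ≠ k₀ → f k + z k < f k₀ + z k₀} =
      (MeasurableEquiv.piEquivPiSubtypeProd (fun _ : K => ℝ) (fun k => k = k₀)) ⁻¹' S := by
    ext z
    simp [hS, MeasurableEquiv.piEquivPiSubtypeProd, Equiv.piEquivPiSubtypeProd]
  rw [hpre, hmp.measure_preimage hSm.nullMeasurableSet, Measure.prod_apply hSm]
  set c : ℝ := ∑ k : {k // ¬ k = k₀}, Real.exp (-(f k₀ - f k)) with hc
  have hc0 : 0 ≤ c := Finset.sum_nonneg fun _ _ => (Real.exp_pos _).le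
  have hin : ∀ x : {k // k = k₀} → ℝ,
      (Measure.pi fun _ : {k // ¬ k = k₀} => μ) (Prod.mk x ⁻¹' S)
        = ENNReal.ofReal (gumG (x ⟨k₀, rfl⟩) ^ c) := by
    intro x
    have e : Prod.mk x ⁻¹' S = Set.pi Set.univ
        (fun k : {k // ¬ k = k₀} => Set.Iio (x ⟨k₀, rfl⟩ + (f k₀ - f k))) := by
      ext y
      simp only [hS, Set.mem_preimage, Set.mem_ofPred_eq, Set.mem_pi, Set.mem_univ, true_imp_iff,
        Set.mem_Iio]
      refine forall_congr' fun k => ?_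
      constructor <;> intro h <;> linarith
    rw [e, Measure.pi_pi]
    simp_rw [gum_Iio μ hμ, gumG_shift]
    rw [← ENNReal.ofReal_prod_of_nonneg (fun _ _ => Real.rpow_nonneg (gumG_pos _).le _),
      hc, Real.rpow_sum_of_pos (gumG_pos _)]
  simp_rw [hin]
  have hev := measurePreserving_eval (fun _ : {k // k = k₀} => μ) ⟨k₀, rfl⟩
  have hm : Measurable fun t : ℝ => ENNReal.ofReal (gumG t ^ c) := by
    have := gumG_cont.measurable
    fun_prop
  have h2 := hev.lintegral_comp hm
  simp only [Function.eval] at h2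
  rw [Subsingleton.elim (Fintype.subtypeEq k₀) (Subtype.fintype fun k => k = k₀)] at h2
  refine h2.trans ?_
  rw [gum_lint μ hμ c hc0]
  congr 1
  have hsum : ∑ k : K, Real.exp (f k) = Real.exp (f k₀) * (1 + c) := by
    rw [← Finset.add_sum_erase _ _ (Finset.mem_univ k₀), mul_add, mul_one, hc, Finset.mul_sum]
    congr 1
    rw [← Finset.sum_subtype (Finset.univ.erase k₀) (p := fun k => ¬ k = k₀) (by simp)
      (fun k => Real.exp (f k₀) * Real.exp (-(f k₀ - f k)))]
    refine Finset.sum_congr rfl fun k _ => ?_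
    rw [← Real.exp_add]
    congr 1
    ring
  rw [hsum]
  have := Real.exp_pos (f k₀)
  field_simp

/-- **Perturb-and-MAP samples from the Gibbs distribution.** Let `K` be a nonempty finite
set, `f : K → ℝ`, and `(z_k)_{k ∈ K}` independent mean-zero Gumbel random variables
(modeled by the product measure `μ^{⊗K}` of the mean-zero Gumbel distribution `μ`, whose
CDF is `t ↦ exp (−exp (−(t+γ)))` with `γ` the Euler–Mascheroni constant). Then almost
surely the maximizer of `k ↦ f k + z k` is unique, and for every `k₀ ∈ K` the probability
that `k₀` is the strict maximizer equals the softmax probability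
`exp (f k₀) / ∑_k exp (f k)`. -/
theorem gumbel_argmax_unique_and_softmax
    {K : Type} [Fintype K] [Nonempty K] (f : K → ℝ)
    (μ : Measure ℝ) [IsProbabilityMeasure μ]
    (hμ : ∀ t : ℝ, μ (Set.Iic t)
      = ENNReal.ofReal (Real.exp (-Real.exp (-(t + Real.eulerMascheroniConstant))))) :
    (∀ᵐ z : K → ℝ ∂(Measure.pi fun _ => μ),
        ∃! k : K, ∀ k' : K, f k' + z k' ≤ f k + z k) ∧
    ∀ k₀ : K,
      (Measure.pi fun _ : K => μ) {z : K → ℝ | ∀ k : K, k ≠ k₀ → f k + z k < f k₀ + z k₀}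
        = ENNReal.ofReal (Real.exp (f k₀) / ∑ k : K, Real.exp (f k)) := by
  have hs := gum_softmax f μ hμ
  refine ⟨?_, hs⟩
  set E : K → Set (K → ℝ) := fun k₀ => {z | ∀ k : K, k ≠ k₀ → f k + z k < f k₀ + z k₀} with hE
  have hEm : ∀ k, MeasurableSet (E k) := fun k => gum_meas f k
  have hdisj : Pairwise (Function.onFun Disjoint E) := by
    intro a b hab
    refine Set.disjoint_left.2 fun z ha hb => ?_
    exact lt_asymm (ha b hab.symm) (hb a hab)
  have hpos : 0 < ∑ k : K, Real.exp (f k) :=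
    Finset.sum_pos (fun _ _ => Real.exp_pos _) Finset.univ_nonempty
  have hone : (Measure.pi fun _ : K => μ) (⋃ k, E k) = 1 := by
    rw [measure_iUnion hdisj hEm, tsum_fintype]
    simp_rw [hE, hs]
    rw [← ENNReal.ofReal_sum_of_nonneg (fun _ _ => div_nonneg (Real.exp_pos _).le hpos.le),
      ← Finset.sum_div, div_self hpos.ne', ENNReal.ofReal_one]
  have hae := (prob_compl_eq_zero_iff (MeasurableSet.iUnion hEm)).2 hone
  have hae' : ∀ᵐ z ∂(Measure.pi fun _ : K => μ), z ∈ ⋃ k, E k := hae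
  filter_upwards [hae'] with z hz
  obtain ⟨k, hk⟩ := Set.mem_iUnion.1 hz
  refine ⟨k, fun k' => ?_, fun j hj => ?_⟩
  · by_cases h : k' = k
    · rw [h]
    · exact (hk k' h).le
  · by_contra h
    exact absurd (hj k) (not_le.2 (hk j h))
end

section
/- Let K be a nonempty finite set, f : K → ℝ, and let (z_k)_{k∈K} be independent random variables each distributed according to the mean-zero Gumbel distribution. Then the random variable M = max_{k∈K} ( f(k) + z_k ) is Gumbel-distributed with location log Σ_{k∈K} exp(f(k)); that is, for every t ∈ ℝ, P(M ≤ t) = exp( −exp( −( t − log Σ_{k∈K} exp(f(k)) + γ ) ) ). -/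
open MeasureTheory Real

/-- **Max-stability of the Gumbel distribution.** Let `K` be a nonempty finite set,
`f : K → ℝ`, and `(z_k)_{k ∈ K}` independent mean-zero Gumbel random variables (modeled by
the product measure `μ^{⊗K}` of the mean-zero Gumbel distribution `μ`, whose CDF is
`t ↦ exp (−exp (−(t+γ)))` with `γ` the Euler–Mascheroni constant). Then the random
variable `M = max_k ( f k + z k )` is Gumbel-distributed with location
`log ∑_k exp (f k)`: for every `t`,
`P(M ≤ t) = exp (−exp (−(t − log ∑_k exp (f k) + γ)))`. -/
theorem gumbel_max_stability
    {K : Type} [Fintype K] [Nonempty K] (f : K → ℝ)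
    (μ : Measure ℝ) [IsProbabilityMeasure μ]
    (hμ : ∀ t : ℝ, μ (Set.Iic t)
      = ENNReal.ofReal (Real.exp (-Real.exp (-(t + Real.eulerMascheroniConstant))))) :
    ∀ t : ℝ,
      (Measure.pi fun _ : K => μ)
          {z : K → ℝ | Finset.univ.sup' Finset.univ_nonempty (fun k : K => f k + z k) ≤ t}
        = ENNReal.ofReal
            (Real.exp (-Real.exp
              (-(t - Real.log (∑ k : K, Real.exp (f k)) + Real.eulerMascheroniConstant)))) := by
  intro t
  have hset : {z : K → ℝ | Finset.univ.sup' Finset.univ_nonempty (fun k : K => f k + z k) ≤ t}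
      = Set.univ.pi (fun k => Set.Iic (t - f k)) := by
    ext z
    simp only [Set.mem_setOf_eq, Finset.sup'_le_iff, Finset.mem_univ, true_imp_iff,
      Set.mem_pi, Set.mem_univ, Set.mem_Iic]
    exact forall_congr' fun k => ⟨fun h => by linarith, fun h => by linarith⟩
  have hpos : 0 < ∑ k : K, Real.exp (f k) :=
    Finset.sum_pos (fun k _ => Real.exp_pos _) Finset.univ_nonempty
  rw [hset, Measure.pi_pi]
  simp only [hμ]
  rw [← ENNReal.ofReal_prod_of_nonneg (fun k _ => (Real.exp_pos _).le), ← Real.exp_sum,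
    Finset.sum_neg_distrib]
  congr 3
  have h1 : -(t - Real.log (∑ k : K, Real.exp (f k)) + Real.eulerMascheroniConstant)
      = Real.log (∑ k : K, Real.exp (f k)) + -(t + Real.eulerMascheroniConstant) := by ring
  rw [h1, Real.exp_add, Real.exp_log hpos, Finset.sum_mul]
  refine Finset.sum_congr rfl fun k _ => ?_
  rw [← Real.exp_add]
  congr 1
  ring
end

section
/- If f : Y → ℝ is separable, i.e., f(y) = Σ_{d=1}^D f_d(y_d) for some functions f_d : Y_d → ℝ, then the Gumbel perturb-and-MAP bound is tight: A_G(f) = A(f), where A(f) = log Σ_{y∈Y} exp(f(y)). -/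
open MeasureTheory Real

section GumbelHelpers

open Set Filter Topology

local notation "γ" => Real.eulerMascheroniConstant

lemma gum_mellin : MellinConvergent (fun t : ℝ => Real.log t • ((Real.exp (-t) : ℝ) : ℂ)) 1 := by
  refine (mellin_hasDerivAt_of_isBigO_rpow (E := ℂ) (a := 2) (b := 0) ?_ ?_ (by simp) ?_
    (by simp)).1
  · refine (Continuous.continuousOn ?_).locallyIntegrableOn measurableSet_Ioi
    exact Complex.continuous_ofReal.comp (Real.continuous_exp.comp continuous_neg)
  · rw [← Asymptotics.isBigO_norm_left]
    simp_rw [Complex.norm_real, Asymptotics.isBigO_norm_left]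
    simpa only [neg_one_mul] using (isLittleO_exp_neg_mul_rpow_atTop zero_lt_one _).isBigO
  · simp_rw [neg_zero, rpow_zero]
    refine Asymptotics.isBigO_const_of_tendsto (?_ : Tendsto _ _ (𝓝 (1 : ℂ))) one_ne_zero
    rw [(by simp : (1 : ℂ) = Real.exp (-0))]
    exact (Complex.continuous_ofReal.comp
      (Real.continuous_exp.comp continuous_neg)).continuousWithinAt

lemma gum_integrable_s4 : IntegrableOn (fun t : ℝ => Real.log t * Real.exp (-t)) (Ioi 0) := by
  have h := gum_mellin
  unfold MellinConvergent at h
  have h2 := h.re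
  refine Integrable.congr h2 ?_
  filter_upwards with t
  simp [-Complex.ofReal_exp]

lemma gum_integral : ∫ t in Ioi (0:ℝ), Real.log t * Real.exp (-t) = -γ := by
  have h1 := Complex.hasDerivAt_GammaIntegral (s := 1) (by simp)
  have h2 : HasDerivAt Complex.GammaIntegral (-γ : ℂ) 1 := by
    refine Complex.hasDerivAt_Gamma_one.congr_of_eventuallyEq ?_
    have : IsOpen {s : ℂ | 0 < s.re} := Complex.continuous_re.isOpen_preimage _ isOpen_Ioi
    filter_upwards [this.mem_nhds (x := 1) (by simp)] with a ha
    exact (Complex.Gamma_eq_integral ha).symm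
  have h3 := h1.unique h2
  simp only [sub_self, Complex.cpow_zero, one_mul] at h3
  have h4 : ∫ t in Ioi (0:ℝ), ((Real.log t : ℂ) * (Real.exp (-t) : ℂ))
      = ((∫ t in Ioi (0:ℝ), Real.log t * Real.exp (-t) : ℝ) : ℂ) := by
    rw [← integral_complex_ofReal]
    simp
  rw [h4] at h3
  exact_mod_cast h3

noncomputable def gumNu : Measure ℝ :=
  (volume.restrict (Ioi 0)).withDensity (fun x => ENNReal.ofReal (Real.exp (-x)))

lemma gumNu_Ici (a : ℝ) (ha : 0 < a) : gumNu (Ici a) = ENNReal.ofReal (Real.exp (-a)) := by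
  rw [gumNu, withDensity_apply _ measurableSet_Ici, Measure.restrict_restrict measurableSet_Ici,
    inter_eq_left.2 (Ici_subset_Ioi.2 ha), setLIntegral_congr Ioi_ae_eq_Ici.symm,
    ← ofReal_integral_eq_lintegral_ofReal (integrableOn_exp_neg_Ioi a)
      (ae_of_all _ fun x => (Real.exp_pos _).le), integral_exp_neg_Ioi]

lemma gum_law (μ : Measure ℝ) [IsProbabilityMeasure μ]
    (hμ : ∀ t : ℝ, μ (Set.Iic t) = ENNReal.ofReal (Real.exp (-Real.exp (-(t + γ))))) :
    μ = gumNu.map (fun x => -Real.log x - γ) := by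
  refine Measure.ext_of_Iic _ _ fun t => ?_
  have hm : Measurable (fun x => -Real.log x - γ) := by fun_prop
  rw [hμ, Measure.map_apply hm measurableSet_Iic, ← gumNu_Ici _ (Real.exp_pos _)]
  refine measure_congr ?_
  have hpos : ∀ᵐ x ∂gumNu, 0 < x :=
    (withDensity_absolutelyContinuous _ _).ae_le (ae_restrict_mem measurableSet_Ioi)
  filter_upwards [hpos] with x hx
  refine propext ?_
  change Real.exp (-(t + γ)) ≤ x ↔ -Real.log x - γ ≤ t
  rw [← Real.le_log_iff_exp_le hx]
  constructor <;> intro h <;> linarith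

lemma gum_nu_log : Integrable Real.log gumNu ∧ ∫ x, Real.log x ∂gumNu = -γ := by
  have hm : Measurable (fun x : ℝ => ENNReal.ofReal (Real.exp (-x))) := by fun_prop
  have hlt : ∀ᵐ x ∂(volume.restrict (Ioi (0:ℝ))), ENNReal.ofReal (Real.exp (-x)) < ⊤ :=
    ae_of_all _ fun x => ENNReal.ofReal_lt_top
  have he : ∀ x : ℝ, (ENNReal.ofReal (Real.exp (-x))).toReal • Real.log x
      = Real.log x * Real.exp (-x) := fun x => by
    rw [ENNReal.toReal_ofReal (Real.exp_pos _).le, smul_eq_mul, mul_comm]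
  constructor
  · rw [gumNu, integrable_withDensity_iff_integrable_smul' hm hlt]
    simp_rw [he]
    exact gum_integrable_s4
  · rw [gumNu, integral_withDensity_eq_integral_toReal_smul hm hlt]
    simp_rw [he]
    exact gum_integral

lemma gum_mean (μ : Measure ℝ) [IsProbabilityMeasure μ]
    (hμ : ∀ t : ℝ, μ (Set.Iic t) = ENNReal.ofReal (Real.exp (-Real.exp (-(t + γ))))) :
    Integrable (fun x => x) μ ∧ ∫ x, x ∂μ = 0 := by
  have hm : Measurable (fun x => -Real.log x - γ) := by fun_prop
  have hl := gum_law μ hμ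
  have hp : IsProbabilityMeasure gumNu := by
    constructor
    have := measure_univ (μ := μ)
    rwa [hl, Measure.map_apply hm MeasurableSet.univ, preimage_univ] at this
  obtain ⟨h1, h2⟩ := gum_nu_log
  constructor
  · rw [hl, integrable_map_measure (by fun_prop) hm.aemeasurable]
    exact h1.neg.sub (integrable_const _)
  · rw [hl, integral_map hm.aemeasurable (by fun_prop),
      integral_sub h1.fun_neg (integrable_const _), integral_neg, h2]
    simp

/-- the law of a maximum of shifted Gumbels is a shifted Gumbel -/
lemma gum_max {D : ℕ} {Y : Fin D → Type} [∀ d, Fintype (Y d)] [∀ d, Nonempty (Y d)]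
    (fd : ∀ d : Fin D, Y d → ℝ)
    (μ : Measure ℝ) [IsProbabilityMeasure μ]
    (hμ : ∀ t : ℝ, μ (Set.Iic t) = ENNReal.ofReal (Real.exp (-Real.exp (-(t + γ)))))
    (d : Fin D) :
    Integrable (fun z : ((d : Fin D) × Y d) → ℝ =>
      Finset.univ.sup' Finset.univ_nonempty (fun k : Y d => fd d k + z ⟨d, k⟩))
      (Measure.pi fun _ => μ) ∧
    ∫ z : ((d : Fin D) × Y d) → ℝ,
      Finset.univ.sup' Finset.univ_nonempty (fun k : Y d => fd d k + z ⟨d, k⟩)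
      ∂(Measure.pi fun _ => μ) = Real.log (∑ k, Real.exp (fd d k)) := by
  classical
  set M : (((d : Fin D) × Y d) → ℝ) → ℝ := fun z =>
    Finset.univ.sup' Finset.univ_nonempty (fun k : Y d => fd d k + z ⟨d, k⟩) with hM
  set c := Real.log (∑ k, Real.exp (fd d k)) with hc
  have hS : 0 < ∑ k, Real.exp (fd d k) :=
    Finset.sum_pos (fun k _ => Real.exp_pos _) Finset.univ_nonempty
  have hMm : Measurable M := by
    rw [hM]
    have := Finset.measurable_sup' (s := Finset.univ) Finset.univ_nonempty
      (f := fun (k : Y d) (z : ((d : Fin D) × Y d) → ℝ) => fd d k + z ⟨d, k⟩)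
      (fun k _ => by fun_prop)
    convert this using 1
    ext z
    simp
  have hlaw : (Measure.pi fun _ => μ).map M = μ.map (fun x => x + c) := by
    haveI : IsProbabilityMeasure ((Measure.pi fun _ : ((d : Fin D) × Y d) => μ).map M) :=
      Measure.isProbabilityMeasure_map hMm.aemeasurable
    refine Measure.ext_of_Iic _ _ fun t => ?_
    rw [Measure.map_apply hMm measurableSet_Iic,
      Measure.map_apply (by fun_prop) measurableSet_Iic]
    have e1 : (fun x : ℝ => x + c) ⁻¹' Iic t = Iic (t - c) := by
      ext x; simp [le_sub_iff_add_le]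
    have e2 : M ⁻¹' Iic t = Set.univ.pi (fun i : (d : Fin D) × Y d =>
        if i.1 = d then Iic (t - fd i.1 i.2) else Set.univ) := by
      ext z
      simp only [hM, mem_preimage, mem_Iic, Finset.sup'_le_iff, Finset.mem_univ, true_imp_iff,
        Set.mem_pi, Set.mem_univ]
      constructor
      · rintro h ⟨d', k⟩
        by_cases hd : d' = d
        · subst hd
          have := h k
          simp only [if_true, mem_Iic]
          linarith
        · simp [hd]
      · intro h k
        have := h ⟨d, k⟩
        simp only [if_true, mem_Iic] at this
        linarith
    rw [e1, e2, Measure.pi_pi, Fintype.prod_sigma, Finset.prod_eq_single d]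
    · simp only [if_true, hμ]
      rw [← ENNReal.ofReal_prod_of_nonneg (fun _ _ => (Real.exp_pos _).le), ← Real.exp_sum,
        Finset.sum_neg_distrib]
      congr 3
      have : ∀ k, Real.exp (-(t - fd d k + γ)) = Real.exp (fd d k) * Real.exp (-(t + γ)) := by
        intro k; rw [← Real.exp_add]; congr 1; ring
      simp_rw [this]
      rw [← Finset.sum_mul, show -(t - c + γ) = c + -(t + γ) by ring, Real.exp_add, hc,
        Real.exp_log hS]
    · intro d' _ hd
      simp [hd]
    · simp
  obtain ⟨g1, g2⟩ := gum_mean μ hμ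
  have hs : Measurable (fun x : ℝ => x + c) := by fun_prop
  constructor
  · have h : Integrable (fun x => x) ((Measure.pi fun _ : ((d : Fin D) × Y d) => μ).map M) := by
      rw [hlaw, integrable_map_measure (by fun_prop) hs.aemeasurable]
      exact g1.add (integrable_const _)
    rw [integrable_map_measure (by fun_prop) hMm.aemeasurable] at h
    exact h
  · have h : ∫ x, x ∂((Measure.pi fun _ : ((d : Fin D) × Y d) => μ).map M) = c := by
      rw [hlaw, integral_map hs.aemeasurable (by fun_prop), integral_add g1 (integrable_const _),
        g2]
      simp
    rw [integral_map hMm.aemeasurable (by fun_prop)] at h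
    exact h

lemma gum_sup {D : ℕ} {Y : Fin D → Type} [∀ d, Fintype (Y d)] [∀ d, Nonempty (Y d)]
    (g : ∀ d : Fin D, Y d → ℝ) :
    Finset.univ.sup' Finset.univ_nonempty (fun y : ∀ d, Y d => ∑ d, g d (y d))
      = ∑ d, Finset.univ.sup' Finset.univ_nonempty (g d) := by
  apply le_antisymm
  · refine Finset.sup'_le _ _ fun y _ => Finset.sum_le_sum fun d _ => ?_
    exact Finset.le_sup' (g d) (Finset.mem_univ _)
  · have : ∀ d, ∃ k, Finset.univ.sup' Finset.univ_nonempty (g d) = g d k := fun d => by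
      obtain ⟨k, _, hk⟩ := Finset.exists_mem_eq_sup' (Finset.univ_nonempty (α := Y d)) (g d)
      exact ⟨k, hk⟩
    choose y hy using this
    simp_rw [hy]
    exact Finset.le_sup' (fun y : ∀ d, Y d => ∑ d, g d (y d)) (Finset.mem_univ y)

end GumbelHelpers


/-- **Tightness of the Gumbel bound for separable potentials.** If the potential
`f : Y₁ × ⋯ × Y_D → ℝ` is separable, i.e. `f y = ∑_d f_d (y_d)`, then the Gumbel
perturb-and-MAP bound is tight: `A_G(f) = A(f)`, where `A(f) = log ∑_y exp (f y)` and
`A_G(f) = E_{z ∼ μ^{⊗I}} [ max_y ( f y + ∑_d z (d, y_d) ) ]` with `μ` the mean-zero Gumbel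
distribution (CDF `t ↦ exp (−exp (−(t+γ)))`, `γ` the Euler–Mascheroni constant) and
`I = {(d, k) : d ∈ {1,…,D}, k ∈ Y_d}`. -/
theorem gumbel_perturb_and_MAP_tight_of_separable
    {D : ℕ} {Y : Fin D → Type} [∀ d, Fintype (Y d)] [∀ d, Nonempty (Y d)]
    (f : (∀ d, Y d) → ℝ) (fd : ∀ d : Fin D, Y d → ℝ)
    (hf : ∀ y : ∀ d, Y d, f y = ∑ d : Fin D, fd d (y d))
    (μ : Measure ℝ) [IsProbabilityMeasure μ]
    (hμ : ∀ t : ℝ, μ (Set.Iic t)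
      = ENNReal.ofReal (Real.exp (-Real.exp (-(t + Real.eulerMascheroniConstant))))) :
    ∫ z : ((d : Fin D) × Y d) → ℝ,
        (Finset.univ.sup' Finset.univ_nonempty
          (fun y : ∀ d, Y d => f y + ∑ d : Fin D, z ⟨d, y d⟩))
        ∂(Measure.pi fun _ => μ)
      = Real.log (∑ y : ∀ d, Y d, Real.exp (f y)) := by
  have e : ∀ z : ((d : Fin D) × Y d) → ℝ, (Finset.univ.sup' Finset.univ_nonempty
          (fun y : ∀ d, Y d => f y + ∑ d : Fin D, z ⟨d, y d⟩))
      = ∑ d, Finset.univ.sup' Finset.univ_nonempty (fun k : Y d => fd d k + z ⟨d, k⟩) := by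
    intro z
    rw [← gum_sup (fun d k => fd d k + z ⟨d, k⟩)]
    simp only [hf, Finset.sum_add_distrib]
  simp_rw [e]
  rw [integral_finsetSum _ (fun d _ => (gum_max fd μ hμ d).1),
    Finset.sum_congr rfl (fun d _ => (gum_max fd μ hμ d).2), ← Real.log_prod]
  · congr 1
    simp_rw [hf, Real.exp_sum]
    exact Fintype.prod_sum fun d k => Real.exp (fd d k)
  · intro d _
    exact (Finset.sum_pos (fun k _ => Real.exp_pos _) Finset.univ_nonempty).ne'
end

section
/- The mean-zero Gumbel distribution has expectation zero: if μ is the Borel probability measure on ℝ with cumulative distribution function F(t) = exp(−exp(−(t+γ))), where γ is the Euler–Mascheroni constant, then the identity function is μ-integrable and ∫_ℝ t dμ(t) = 0. Equivalently, the standard Gumbel distribution (cumulative distribution function t ↦ exp(−exp(−t))) has mean equal to the Euler–Mascheroni constant γ. -/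
open MeasureTheory Real

lemma gumbel_aux_log :
    IntegrableOn (fun t : ℝ => Real.log t * Real.exp (-t)) (Set.Ioi 0) ∧
    ∫ t in Set.Ioi (0 : ℝ), Real.log t * Real.exp (-t) = -Real.eulerMascheroniConstant := by
  have h1 : LocallyIntegrableOn (fun x : ℝ => ((Real.exp (-x) : ℝ) : ℂ)) (Set.Ioi 0) := by
    refine (Continuous.continuousOn ?_).locallyIntegrableOn measurableSet_Ioi
    exact Complex.continuous_ofReal.comp (Real.continuous_exp.comp continuous_neg)
  have h2 : (fun x : ℝ => ((Real.exp (-x) : ℝ) : ℂ)) =O[Filter.atTop] (· ^ (-(2:ℝ))) := by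
    rw [← Asymptotics.isBigO_norm_left]
    simp_rw [Complex.norm_real, Asymptotics.isBigO_norm_left]
    simpa only [neg_one_mul] using (isLittleO_exp_neg_mul_rpow_atTop zero_lt_one _).isBigO
  have h3 : (fun x : ℝ => ((Real.exp (-x) : ℝ) : ℂ)) =O[nhdsWithin 0 (Set.Ioi 0)]
      (· ^ (-(0:ℝ))) := by
    simp_rw [neg_zero, Real.rpow_zero]
    refine Asymptotics.isBigO_const_of_tendsto (y := (1:ℂ)) ?_ one_ne_zero
    rw [(by simp : (1 : ℂ) = Real.exp (-0))]
    exact (Complex.continuous_ofReal.comp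
      (Real.continuous_exp.comp continuous_neg)).continuousWithinAt
  obtain ⟨hc, hd⟩ := mellin_hasDerivAt_of_isBigO_rpow (s := 1) h1 h2 (by norm_num) h3 (by norm_num)
  have hd' : HasDerivAt Complex.Gamma _ 1 := hd.congr_of_eventuallyEq (by
    have : {z : ℂ | 0 < z.re} ∈ nhds (1:ℂ) :=
      (isOpen_lt continuous_const Complex.continuous_re).mem_nhds (by simp)
    filter_upwards [this] with z hz
    rw [Complex.Gamma_eq_integral hz, Complex.GammaIntegral_eq_mellin])
  have he := hd'.unique Complex.hasDerivAt_Gamma_one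
  have hfun : (fun t : ℝ => (t : ℂ) ^ ((1:ℂ) - 1) • (Real.log t • ((Real.exp (-t) : ℝ) : ℂ)))
      = fun t : ℝ => ((Real.log t * Real.exp (-t) : ℝ) : ℂ) := by
    funext t; simp
  unfold MellinConvergent at hc
  unfold mellin at he
  rw [hfun] at hc he
  constructor
  · exact hc.re
  · rw [integral_complex_ofReal] at he
    exact_mod_cast he

lemma gumbel_aux_std (ν : Measure ℝ) [IsProbabilityMeasure ν]
    (hν : ∀ t : ℝ, ν (Set.Iic t) = ENNReal.ofReal (Real.exp (-Real.exp (-t)))) :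
    Integrable (fun t : ℝ => t) ν ∧ ∫ t : ℝ, t ∂ν = Real.eulerMascheroniConstant := by
  set E : Measure ℝ := (volume.restrict (Set.Ioi 0)).withDensity
    (fun x => ENNReal.ofReal (Real.exp (-x))) with hE
  have hm : Measurable (fun x : ℝ => -Real.log x) := by fun_prop
  have hmap : ν = E.map (fun x => -Real.log x) := by
    refine Measure.ext_of_Iic _ _ fun t => ?_
    rw [hν, Measure.map_apply hm measurableSet_Iic, hE,
      withDensity_apply _ (hm measurableSet_Iic), Measure.restrict_restrict (hm measurableSet_Iic)]
    have : (fun x : ℝ => -Real.log x) ⁻¹' Set.Iic t ∩ Set.Ioi 0 = Set.Ici (Real.exp (-t)) := by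
      ext x
      simp only [Set.mem_inter_iff, Set.mem_preimage, Set.mem_Iic, Set.mem_Ioi, Set.mem_Ici]
      constructor
      · rintro ⟨h, hx⟩
        rw [← Real.le_log_iff_exp_le hx]; linarith
      · intro h
        have hx : 0 < x := (Real.exp_pos _).trans_le h
        rw [← Real.le_log_iff_exp_le hx] at h
        exact ⟨by linarith, hx⟩
    rw [this, setLIntegral_congr Ioi_ae_eq_Ici.symm, ← ofReal_integral_eq_lintegral_ofReal
      (integrableOn_exp_neg_Ioi _) (ae_of_all _ fun x => (Real.exp_pos _).le),
      integral_exp_neg_Ioi]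
  obtain ⟨hi, hv⟩ := gumbel_aux_log
  have hd : Measurable (fun x : ℝ => ENNReal.ofReal (Real.exp (-x))) := by fun_prop
  have hlt : ∀ᵐ x ∂(volume.restrict (Set.Ioi (0:ℝ))), ENNReal.ofReal (Real.exp (-x)) < ⊤ :=
    ae_of_all _ fun x => ENNReal.ofReal_lt_top
  have hfun : (fun x : ℝ => (ENNReal.ofReal (Real.exp (-x))).toReal • (-Real.log x))
      = fun x => -(Real.log x * Real.exp (-x)) := by
    funext x
    rw [ENNReal.toReal_ofReal (Real.exp_pos _).le, smul_eq_mul]; ring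
  rw [hmap]
  constructor
  · rw [integrable_map_measure (by fun_prop) hm.aemeasurable]
    change Integrable (fun x => -Real.log x) E
    rw [hE, integrable_withDensity_iff_integrable_smul' hd hlt, hfun]
    exact hi.neg
  · rw [integral_map hm.aemeasurable (by fun_prop), hE,
      integral_withDensity_eq_integral_toReal_smul hd hlt, hfun, integral_neg, hv, neg_neg]

/-- **The mean-zero Gumbel distribution has expectation zero.** If `μ` is the Borel
probability measure on `ℝ` with CDF `t ↦ exp (−exp (−(t+γ)))`, where `γ` is the
Euler–Mascheroni constant, then the identity function is `μ`-integrable and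
`∫ t dμ(t) = 0`. Equivalently, the standard Gumbel distribution `ν` (CDF
`t ↦ exp (−exp (−t))`) has mean equal to `γ`. -/
theorem gumbel_mean_zero
    (μ ν : Measure ℝ) [IsProbabilityMeasure μ] [IsProbabilityMeasure ν]
    (hμ : ∀ t : ℝ, μ (Set.Iic t)
      = ENNReal.ofReal (Real.exp (-Real.exp (-(t + Real.eulerMascheroniConstant)))))
    (hν : ∀ t : ℝ, ν (Set.Iic t) = ENNReal.ofReal (Real.exp (-Real.exp (-t)))) :
    (Integrable (fun t : ℝ => t) μ ∧ ∫ t : ℝ, t ∂μ = 0) ∧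
    (Integrable (fun t : ℝ => t) ν ∧ ∫ t : ℝ, t ∂ν = Real.eulerMascheroniConstant) := by
  refine ⟨?_, gumbel_aux_std ν hν⟩
  set g := Real.eulerMascheroniConstant with hg
  have hm : Measurable (fun t : ℝ => t + g) := by fun_prop
  have hp : IsProbabilityMeasure (μ.map (fun t => t + g)) :=
    Measure.isProbabilityMeasure_map hm.aemeasurable
  obtain ⟨hi, hv⟩ := gumbel_aux_std (μ.map (fun t => t + g)) (fun t => by
    rw [Measure.map_apply hm measurableSet_Iic]
    have : (fun t : ℝ => t + g) ⁻¹' Set.Iic t = Set.Iic (t - g) := by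
      ext x
      simp [le_sub_iff_add_le]
    rw [this, hμ, sub_add_cancel])
  rw [integrable_map_measure (by fun_prop) hm.aemeasurable] at hi
  rw [integral_map hm.aemeasurable (by fun_prop)] at hv
  have hi' : Integrable (fun t : ℝ => t) μ := by
    have h := hi.sub (integrable_const g)
    simpa [Function.comp_def, Pi.sub_def] using h
  refine ⟨hi', ?_⟩
  rw [integral_add hi' (integrable_const g)] at hv
  simp only [integral_const, probReal_univ, one_smul] at hv
  linarith
end
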